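/- Suppose A ∈ ℂ[L,M] is irreducible, A(−L,M) ≠ A(L,M), and A(L,0) = L^a·(L−1)^{a−1} for some integer a ≥ 1, where A(L,0) denotes the image of A under the ℂ-algebra homomorphism L ↦ L, M ↦ 0. Let R ∈ ℂ[L,M] be the unique polynomial satisfying R(L²,M) = A(L,M)·A(−L,M). Then each of R(L,M) and R(L,M²) is irreducible in ℂ[L,M], and each has L-degree equal to the L-degree of A. -/

import Mathlib

open Polynomial

/-- The image of `R ∈ ℂ[L,M]` under the `ℂ`-algebra homomorphism `L ↦ L`, `M ↦ M²`,
where `ℂ[L,M]` is identified with `Polynomial (Polynomial ℂ)` (outer variable `L`,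
inner variable `M`). -/
noncomputable def substMsq (R : Polynomial (Polynomial ℂ)) : Polynomial (Polynomial ℂ) :=
  R.map (Polynomial.aeval (X ^ 2 : Polynomial ℂ)).toRingHom

/-- The image of `A ∈ ℂ[L,M]` under the `ℂ`-algebra homomorphism `L ↦ L`, `M ↦ 0`,
giving a polynomial in `ℂ[L]`. -/
noncomputable def substM0 (A : Polynomial (Polynomial ℂ)) : Polynomial ℂ :=
  A.map (Polynomial.aeval (0 : ℂ)).toRingHom

section Descent

variable {B : Type*} [CommRing B] [IsDomain B] {ι σ : B →+* B}

/-- If the image of an injective endomorphism `ι` is the fixed ring of `σ`,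
then `ι` reflects divisibility. -/
theorem dvd_of_map_dvd_map_of_fixed (hι : Function.Injective ι) (hσι : ∀ x, σ (ι x) = ι x)
    (hfix : ∀ x, σ x = x → ∃ y, ι y = x) {x y : B} (h : ι x ∣ ι y) : x ∣ y := by
  obtain ⟨q, hq⟩ := h
  by_cases hx : x = 0
  · subst hx
    rw [map_zero, zero_mul, ← map_zero ι] at hq
    rw [hι hq]
  have hx' : ι x ≠ 0 := (map_ne_zero_iff ι hι).2 hx
  have hq' : σ q = q := by
    have h1 := congrArg σ hq
    rw [map_mul, hσι, hσι, hq] at h1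
    exact (mul_left_cancel₀ hx' h1).symm
  obtain ⟨z, rfl⟩ := hfix q hq'
  exact ⟨z, hι (by rw [hq, map_mul])⟩

/-- Irreducibility descends from `A` to the element whose image under `ι` is `A * σ A`. -/
theorem irreducible_of_map_eq_mul_conj (hι : Function.Injective ι) (hσι : ∀ x, σ (ι x) = ι x)
    (hfix : ∀ x, σ x = x → ∃ y, ι y = x) (hσσ : ∀ x, σ (σ x) = x)
    (hunit : ∀ x, IsUnit x → σ x = x) {A R : B} (hA : Prime A) (hne : σ A ≠ A)
    (hR : ι R = A * σ A) : Irreducible R := by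
  have hσA : Irreducible (σ A) :=
    (MulEquiv.irreducible_iff (RingEquiv.ofRingHom σ σ (RingHom.ext hσσ)
      (RingHom.ext hσσ)).toMulEquiv).2 hA.irreducible
  have key : ∀ S T : B, ι S * ι T = A * σ A → A ∣ ι S → IsUnit T := by
    rintro S T h ⟨U, hU⟩
    rw [hU, mul_assoc] at h
    have h := mul_left_cancel₀ hA.ne_zero h
    rcases hσA.isUnit_or_isUnit h.symm with hu | hu
    · refine absurd ?_ hne
      have h1 := congrArg σ hU
      rw [hσι, map_mul, hunit U hu, hU] at h1
      exact (mul_right_cancel₀ hu.ne_zero h1).symm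
    · refine isUnit_of_dvd_one (dvd_of_map_dvd_map_of_fixed hι hσι hfix ?_)
      rw [map_one]
      exact hu.dvd
  refine ⟨fun hu => hA.not_isUnit ?_, fun S T hST => ?_⟩
  · have h1 := hu.map ι
    rw [hR] at h1
    exact isUnit_of_mul_isUnit_left h1
  · have h : ι S * ι T = A * σ A := by rw [← hR, hST, map_mul]
    rcases hA.dvd_or_dvd (h ▸ dvd_mul_right A (σ A) : A ∣ ι S * ι T) with h1 | h1
    · exact Or.inr (key S T h h1)
    · exact Or.inl (key T S (by rw [mul_comm, h]) h1)

/-- The image under `ι` of an irreducible element either stays irreducible or is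
associated to a norm `S * σ S`. -/
theorem irreducible_map_or_associated_mul_conj [UniqueFactorizationMonoid B]
    (hι : Function.Injective ι) (hσι : ∀ x, σ (ι x) = ι x)
    (hfix : ∀ x, σ x = x → ∃ y, ι y = x) (hσσ : ∀ x, σ (σ x) = x)
    {R : B} (hR : Irreducible R) : Irreducible (ι R) ∨ ∃ S, Associated (ι R) (S * σ S) := by
  have hnu : ¬ IsUnit (ι R) := fun hu =>
    hR.not_isUnit (isUnit_of_dvd_one (dvd_of_map_dvd_map_of_fixed hι hσι hfix
      (by rw [map_one]; exact hu.dvd)))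
  have hne : ι R ≠ 0 := (map_ne_zero_iff ι hι).2 hR.ne_zero
  obtain ⟨S, hS, U, hU⟩ := WfDvdMonoid.exists_irreducible_factor hnu hne
  have hσU : ι R = σ S * σ U := by rw [← map_mul, ← hU, hσι]
  obtain ⟨N, hN⟩ := hfix (S * σ S) (by rw [map_mul, hσσ, mul_comm])
  have hdvd : N ∣ R ^ 2 := by
    refine dvd_of_map_dvd_map_of_fixed hι hσι hfix ⟨U * σ U, ?_⟩
    rw [hN, map_pow, sq]
    nth_rewrite 2 [hσU]
    rw [hU]
    ring
  obtain ⟨i, hi, hNi⟩ := (dvd_prime_pow hR.prime 2).1 hdvd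
  have hass : Associated (S * σ S) (ι R ^ i) := by
    rw [← hN, ← map_pow]
    exact hNi.map ι
  interval_cases i
  · rw [pow_zero] at hass
    exact absurd (isUnit_of_mul_isUnit_left (hass.symm.isUnit isUnit_one)) hS.not_isUnit
  · rw [pow_one] at hass
    exact Or.inr ⟨S, hass.symm⟩
  · left
    have h0 : S * σ S ≠ 0 := fun h => pow_ne_zero 2 hne (hass.eq_zero_iff.1 h)
    have h1 : ι R ^ 2 = S * σ S * (U * σ U) := by
      rw [sq]
      nth_rewrite 2 [hσU]
      rw [hU]
      ring
    have hu : IsUnit U := by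
      obtain ⟨u, hu⟩ := hass
      rw [h1] at hu
      have h2 := mul_left_cancel₀ h0 hu
      exact isUnit_of_mul_isUnit_left (h2 ▸ u.isUnit)
    rw [hU]
    exact (irreducible_mul_isUnit hu).2 hS

end Descent

section EvenPolynomials

variable {K : Type*} [CommRing K]

theorem exists_comp_sq_eq_of_comp_neg_X_eq [IsDomain K] (h2 : (2 : K) ≠ 0) (p : K[X])
    (hp : p.comp (-X) = p) : ∃ q : K[X], q.comp (X ^ 2) = p := by
  refine ⟨contract 2 p, ?_⟩
  rw [← expand_eq_comp_X_pow]
  ext n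
  rw [coeff_expand two_pos]
  split_ifs with h
  · rw [coeff_contract two_ne_zero, Nat.div_mul_cancel h]
  · have h1 := congrArg (fun q => coeff q n) hp
    have hX : (-X : K[X]) = C (-1) * X := by simp
    simp only [hX, comp_C_mul_X_coeff] at h1
    rw [(Nat.not_even_iff_odd.1 fun he => h he.two_dvd).neg_one_pow] at h1
    have h3 : (2 : K) * p.coeff n = 0 := by linear_combination -h1
    exact ((mul_eq_zero.1 h3).resolve_left h2).symm

theorem comp_sq_injective : Function.Injective (compRingHom (X ^ 2 : K[X])) := by
  intro p q h
  simp only [coe_compRingHom_apply] at h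
  rw [← expand_eq_comp_X_pow, ← expand_eq_comp_X_pow] at h
  exact expand_injective two_pos h

theorem comp_sq_comp_neg_X (p : K[X]) : (p.comp (X ^ 2)).comp (-X) = p.comp (X ^ 2) := by
  rw [comp_assoc]
  simp

theorem natDegree_eq_of_comp_sq_eq_mul_comp_neg_X [IsDomain K] {A R : K[X]}
    (h : R.comp (X ^ 2) = A * A.comp (-X)) : R.natDegree = A.natDegree := by
  by_cases hA : A = 0
  · subst hA
    rw [zero_mul] at h
    rw [comp_sq_injective (h.trans (zero_comp (p := X ^ 2)).symm)]
  have h0 : A.comp (-X) ≠ 0 := mt comp_neg_X_eq_zero_iff.1 hA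
  have h1 := congrArg natDegree h
  rw [natDegree_mul hA h0, natDegree_comp, natDegree_comp, natDegree_neg, natDegree_X,
    natDegree_X_pow] at h1
  omega

end EvenPolynomials

theorem substMsq_eq_mapRingHom (R : Polynomial (Polynomial ℂ)) :
    substMsq R = mapRingHom (compRingHom (X ^ 2 : ℂ[X])) R := by
  rw [substMsq, coe_mapRingHom]
  congr 1

theorem substM0_eq_mapRingHom (R : Polynomial (Polynomial ℂ)) :
    substM0 R = mapRingHom (evalRingHom (0 : ℂ)) R := by
  rw [substM0, coe_mapRingHom]
  congr 1

theorem substM0_map_comp_neg_X (S : Polynomial (Polynomial ℂ)) :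
    substM0 (mapRingHom (compRingHom (-X : ℂ[X])) S) = substM0 S := by
  rw [substM0_eq_mapRingHom, substM0_eq_mapRingHom]
  ext n
  simp [eval_comp]

theorem substM0_substMsq (R : Polynomial (Polynomial ℂ)) : substM0 (substMsq R) = substM0 R := by
  rw [substMsq_eq_mapRingHom, substM0_eq_mapRingHom, substM0_eq_mapRingHom]
  ext n
  simp [eval_comp]

theorem irreducible_substMsq_of_odd_natDegree {R : Polynomial (Polynomial ℂ)}
    (hR : Irreducible R) (hodd : Odd (substM0 R).natDegree) : Irreducible (substMsq R) := by
  rw [substMsq_eq_mapRingHom]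
  refine (irreducible_map_or_associated_mul_conj (σ := mapRingHom (compRingHom (-X : ℂ[X])))
    (map_injective _ comp_sq_injective) (fun x => ?_) (fun x hx => ?_) (fun x => ?_)
    hR).resolve_right ?_
  · ext1 n
    simp only [coe_mapRingHom, coeff_map, coe_compRingHom_apply, comp_sq_comp_neg_X]
  · have hmem : ∀ n, x.coeff n ∈ (compRingHom (X ^ 2 : ℂ[X])).range := fun n => by
      have h1 := congrArg (fun q => coeff q n) hx
      simp only [coe_mapRingHom, coeff_map, coe_compRingHom_apply] at h1
      exact exists_comp_sq_eq_of_comp_neg_X_eq two_ne_zero _ h1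
    exact (mem_map_range _).2 hmem
  · ext1 n
    simp [comp_assoc]
  · rintro ⟨S, hS⟩
    have h1 := hS.map (mapRingHom (evalRingHom (0 : ℂ)))
    rw [map_mul, ← substM0_eq_mapRingHom, ← substM0_eq_mapRingHom, ← substM0_eq_mapRingHom,
      substM0_map_comp_neg_X, ← substMsq_eq_mapRingHom, substM0_substMsq] at h1
    have h2 := natDegree_eq_of_degree_eq (degree_eq_degree_of_associated h1)
    rw [← sq, natDegree_pow] at h2
    rw [h2] at hodd
    exact (Nat.not_odd_iff_even.2 (even_two_mul _)) hodd

/-- Suppose `A ∈ ℂ[L,M]` is irreducible, `A(−L,M) ≠ A(L,M)`, and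
`A(L,0) = L^a·(L−1)^{a−1}` for some `a ≥ 1`.  If `R(L²,M) = A(L,M)·A(−L,M)`, then
both `R(L,M)` and `R(L,M²)` are irreducible, with `L`-degree equal to that of `A`. -/
theorem irreducible_res_and_subst_sq (A R : Polynomial (Polynomial ℂ)) (a : ℕ)
    (ha : 1 ≤ a) (hA : Irreducible A) (hne : A.comp (-X) ≠ A)
    (hA0 : substM0 A = X ^ a * (X - 1) ^ (a - 1))
    (hR : R.comp (X ^ 2) = A * A.comp (-X)) :
    Irreducible R ∧ Irreducible (substMsq R) ∧
      R.natDegree = A.natDegree ∧ (substMsq R).natDegree = A.natDegree := by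
  have hdeg : R.natDegree = A.natDegree := natDegree_eq_of_comp_sq_eq_mul_comp_neg_X hR
  have hirr : Irreducible R := by
    refine irreducible_of_map_eq_mul_conj (ι := compRingHom (X ^ 2)) (σ := compRingHom (-X))
      comp_sq_injective comp_sq_comp_neg_X
      (exists_comp_sq_eq_of_comp_neg_X_eq two_ne_zero)
      comp_neg_X_comp_neg_X (fun x hx => ?_) hA.prime hne hR
    obtain ⟨r, -, rfl⟩ := isUnit_iff.1 hx
    simp
  have hR0 : (substM0 R).comp (X ^ 2) = substM0 A * (substM0 A).comp (-X) := by
    have h1 := congrArg (mapRingHom (evalRingHom (0 : ℂ))) hR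
    simpa only [substM0_eq_mapRingHom, coe_mapRingHom, Polynomial.map_mul, map_comp,
      Polynomial.map_pow, Polynomial.map_neg, map_X] using h1
  have hdeg0 : (substM0 A).natDegree = a + (a - 1) := by
    rw [hA0, ← C_1, natDegree_mul (pow_ne_zero _ X_ne_zero) (pow_ne_zero _ (X_sub_C_ne_zero 1)),
      natDegree_X_pow, natDegree_pow, natDegree_X_sub_C, mul_one]
  have hodd : Odd (substM0 R).natDegree := by
    rw [natDegree_eq_of_comp_sq_eq_mul_comp_neg_X hR0, hdeg0]
    exact ⟨a - 1, by omega⟩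
  refine ⟨hirr, irreducible_substMsq_of_odd_natDegree hirr hodd, hdeg, ?_⟩
  rw [substMsq_eq_mapRingHom, coe_mapRingHom, natDegree_map_eq_of_injective comp_sq_injective, hdeg]
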